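/- arXiv:2010.07686 — 8 statements merged into one kernel-verified Lean document; each statement's English description precedes it below -/
import Mathlib

section
/- Let p ≥ 2 be a real number and let a, b be elements of a real inner product space E. Then ‖b‖^p ≥ ‖a‖^p + p·⟨‖a‖^{p−2} a, b − a⟩ + 2^{1−p}‖a − b‖^p. -/
open RealInnerProductSpace

/-- Tangent-line inequality for the convex function `t ↦ t ^ p` on `[0, ∞)`. -/
theorem rpow_add_mul_sub_le_rpow {p s t : ℝ} (hp : 1 ≤ p) (hs : 0 < s) (ht : 0 ≤ t) :
    s ^ p + p * s ^ (p - 1) * (t - s) ≤ t ^ p := by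
  have h := one_add_mul_self_le_rpow_one_add (s := t / s - 1)
    (by linarith [div_nonneg ht hs.le]) hp
  rw [add_sub_cancel, Real.div_rpow ht hs.le, le_div_iff₀ (Real.rpow_pos_of_pos hs p)] at h
  refine le_trans (le_of_eq ?_) h
  rw [Real.rpow_sub_one hs.ne']
  field_simp

/-- The supporting hyperplane inequality for the convex function `‖·‖ ^ p`. -/
theorem norm_rpow_add_inner_le_norm_rpow {E : Type*} [NormedAddCommGroup E]
    [InnerProductSpace ℝ E] {p : ℝ} (hp : 1 ≤ p) (a c : E) :
    ‖a‖ ^ p + p * ⟪(‖a‖ ^ (p - 2)) • a, c - a⟫ ≤ ‖c‖ ^ p := by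
  rcases eq_or_ne a 0 with rfl | ha
  · simpa [Real.zero_rpow (by linarith : p ≠ 0)] using Real.rpow_nonneg (norm_nonneg c) p
  have hs : 0 < ‖a‖ := norm_pos_iff.mpr ha
  refine le_trans ?_ (rpow_add_mul_sub_le_rpow hp hs (norm_nonneg c))
  have hpow : ‖a‖ ^ (p - 1) = ‖a‖ ^ (p - 2) * ‖a‖ := by
    rw [← Real.rpow_add_one hs.ne']
    ring_nf
  have hinner : ⟪a, c - a⟫ ≤ ‖a‖ * (‖c‖ - ‖a‖) := by
    rw [inner_sub_right, real_inner_self_eq_norm_sq]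
    nlinarith [real_inner_le_norm a c]
  rw [real_inner_smul_left, hpow, mul_assoc p, mul_assoc (‖a‖ ^ (p - 2))]
  gcongr

/-- Clarkson's inequality in a real inner product space, for exponents `p ≥ 2`. -/
theorem clarkson_inner_product_space {E : Type*} [NormedAddCommGroup E]
    [InnerProductSpace ℝ E] {p : ℝ} (hp : 2 ≤ p) (a b : E) :
    ‖(2⁻¹ : ℝ) • (a + b)‖ ^ p + ‖(2⁻¹ : ℝ) • (a - b)‖ ^ p ≤ (‖a‖ ^ p + ‖b‖ ^ p) / 2 := by
  have hq : 1 ≤ p / 2 := by linarith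
  have hsq (x : E) : ‖x‖ ^ p = (‖x‖ ^ 2) ^ (p / 2) := by
    rw [← Real.rpow_natCast_mul (norm_nonneg x)]
    congr 1
    push_cast
    ring
  have hpar : ‖(2⁻¹ : ℝ) • (a + b)‖ ^ 2 + ‖(2⁻¹ : ℝ) • (a - b)‖ ^ 2 =
      2⁻¹ * ‖a‖ ^ 2 + 2⁻¹ * ‖b‖ ^ 2 := by
    rw [norm_smul, norm_smul, mul_pow, mul_pow, norm_add_sq_real, norm_sub_sq_real]
    norm_num
    ring
  calc ‖(2⁻¹ : ℝ) • (a + b)‖ ^ p + ‖(2⁻¹ : ℝ) • (a - b)‖ ^ p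
      ≤ (2⁻¹ * ‖a‖ ^ 2 + 2⁻¹ * ‖b‖ ^ 2) ^ (p / 2) := by
        rw [hsq, hsq, ← hpar]
        exact Real.add_rpow_le_rpow_add (sq_nonneg _) (sq_nonneg _) hq
    _ ≤ 2⁻¹ * (‖a‖ ^ 2) ^ (p / 2) + 2⁻¹ * (‖b‖ ^ 2) ^ (p / 2) :=
        (convexOn_rpow hq).2 (sq_nonneg ‖a‖) (sq_nonneg ‖b‖) (by norm_num) (by norm_num)
          (by norm_num)
    _ = (‖a‖ ^ p + ‖b‖ ^ p) / 2 := by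
        rw [hsq a, hsq b]
        ring

/-- Lindqvist-type vector inequality: for `p ≥ 2` and `a, b` in a real inner
product space, `‖b‖^p ≥ ‖a‖^p + p⟨‖a‖^{p-2} a, b - a⟩ + 2^{1-p}‖a - b‖^p`. -/
theorem lindqvist_vector_inequality
    {E : Type*} [NormedAddCommGroup E] [InnerProductSpace ℝ E]
    (p : ℝ) (hp : 2 ≤ p) (a b : E) :
    ‖b‖ ^ p ≥
      ‖a‖ ^ p + p * ⟪(‖a‖ ^ (p - 2)) • a, b - a⟫ + (2 : ℝ) ^ (1 - p) * ‖a - b‖ ^ p := by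
  have hclarkson := clarkson_inner_product_space hp a b
  have htangent := norm_rpow_add_inner_le_norm_rpow (by linarith : 1 ≤ p) a
    ((2⁻¹ : ℝ) • (a + b))
  have hmid : (2⁻¹ : ℝ) • (a + b) - a = (2⁻¹ : ℝ) • (b - a) := by module
  have hdiff : (2 : ℝ) ^ (1 - p) * ‖a - b‖ ^ p = 2 * ‖(2⁻¹ : ℝ) • (a - b)‖ ^ p := by
    rw [norm_smul, Real.mul_rpow (norm_nonneg _) (norm_nonneg _), Real.norm_of_nonneg (by norm_num),
      Real.inv_rpow (by norm_num), Real.rpow_sub (by norm_num), Real.rpow_one]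
    ring
  rw [hmid, real_inner_smul_right] at htangent
  rw [hdiff]
  linarith
end

section
/- Let p ≥ 2 be a real number, let l ∈ [0, 1], and let A, B, C, D be nonnegative real numbers satisfying A² + (l/4)·B² ≤ (C² + D²)/2. Then A^p + (l^{p/2}/2^p)·B^p ≤ (C^p + D^p)/2. -/
theorem Real.rpow_add_rpow_le_rpow_add {x y q : ℝ} (hx : 0 ≤ x) (hy : 0 ≤ y) (hq : 1 ≤ q) :
    x ^ q + y ^ q ≤ (x + y) ^ q := by
  lift x to NNReal using hx
  lift y to NNReal using hy
  exact_mod_cast NNReal.add_rpow_le_rpow_add x y hq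

theorem Real.rpow_midpoint_le {x y q : ℝ} (hx : 0 ≤ x) (hy : 0 ≤ y) (hq : 1 ≤ q) :
    ((x + y) / 2) ^ q ≤ (x ^ q + y ^ q) / 2 := by
  have h := (convexOn_rpow hq).2 (Set.mem_Ici.2 hx) (Set.mem_Ici.2 hy)
    (by norm_num : (0 : ℝ) ≤ 1 / 2) (by norm_num : (0 : ℝ) ≤ 1 / 2) (by norm_num)
  simp only [smul_eq_mul] at h
  calc ((x + y) / 2) ^ q = (1 / 2 * x + 1 / 2 * y) ^ q := by ring_nf
    _ ≤ 1 / 2 * x ^ q + 1 / 2 * y ^ q := h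
    _ = (x ^ q + y ^ q) / 2 := by ring

theorem Real.sq_rpow_half {x : ℝ} (hx : 0 ≤ x) (p : ℝ) : (x ^ 2) ^ (p / 2) = x ^ p := by
  rw [← Real.rpow_natCast_mul hx]
  congr 1
  push_cast
  ring

/-- Scalar form of the intermediate estimate in Lemma 3.1: if
`A² + (l/4)B² ≤ (C² + D²)/2` with `l ∈ [0,1]`, `p ≥ 2`, and `A, B, C, D ≥ 0`,
then `A^p + (l^{p/2}/2^p)B^p ≤ (C^p + D^p)/2`. -/
theorem scalar_uniform_convexity_step
    (p l A B C D : ℝ) (hp : 2 ≤ p) (hl0 : 0 ≤ l) (hl1 : l ≤ 1)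
    (hA : 0 ≤ A) (hB : 0 ≤ B) (hC : 0 ≤ C) (hD : 0 ≤ D)
    (h : A ^ 2 + l / 4 * B ^ 2 ≤ (C ^ 2 + D ^ 2) / 2) :
    A ^ p + l ^ (p / 2) / 2 ^ p * B ^ p ≤ (C ^ p + D ^ p) / 2 := by
  have hq : 1 ≤ p / 2 := by linarith
  have hlB : (l / 4 * B ^ 2) ^ (p / 2) = l ^ (p / 2) / 2 ^ p * B ^ p := by
    rw [Real.mul_rpow (by positivity) (by positivity), Real.div_rpow hl0 (by norm_num),
      Real.sq_rpow_half hB, show (4 : ℝ) = 2 ^ 2 by norm_num, Real.sq_rpow_half (by norm_num)]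
  calc A ^ p + l ^ (p / 2) / 2 ^ p * B ^ p
      = (A ^ 2) ^ (p / 2) + (l / 4 * B ^ 2) ^ (p / 2) := by rw [hlB, Real.sq_rpow_half hA]
    _ ≤ (A ^ 2 + l / 4 * B ^ 2) ^ (p / 2) :=
      Real.rpow_add_rpow_le_rpow_add (by positivity) (by positivity) hq
    _ ≤ ((C ^ 2 + D ^ 2) / 2) ^ (p / 2) :=
      Real.rpow_le_rpow (by positivity) h (by linarith)
    _ ≤ ((C ^ 2) ^ (p / 2) + (D ^ 2) ^ (p / 2)) / 2 :=
      Real.rpow_midpoint_le (by positivity) (by positivity) hq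
    _ = (C ^ p + D ^ p) / 2 := by rw [Real.sq_rpow_half hC, Real.sq_rpow_half hD]
end

section
/- Let E be a finite-dimensional real vector space, let p ≥ 2 be a real number, and let F : E → ℝ be a continuous nonnegative function that is positively homogeneous of degree one (F(t y) = t F(y) for all t ≥ 0 and y ∈ E) and differentiable on E ∖ {0}. Assume there is a constant l ∈ [0, 1] such that F(t ξ + (1 − t) β)² ≤ t F(ξ)² + (1 − t) F(β)² − l · t(1 − t) · F(β − ξ)² for all ξ, β ∈ E and all t ∈ [0, 1]. Then for every ξ ∈ E ∖ {0} and every β ∈ E one has F(β)^p ≥ F(ξ)^p + p · F(ξ)^{p−2} · D(½F²)(ξ)(β − ξ) + (l^{p/2}/2^{p−1}) · F(β − ξ)^p, where D(½F²)(ξ) denotes the (Fréchet) derivative of the function y ↦ ½ F(y)² at ξ. -/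
/-- A convex function lies above its tangent at any point of differentiability. -/
theorem ConvexOn.add_hasFDerivAt_apply_sub_le {V : Type*} [NormedAddCommGroup V]
    [NormedSpace ℝ V] {s : Set V} {f : V → ℝ} {f' : V →L[ℝ] ℝ} {x y : V}
    (hf : ConvexOn ℝ s f) (hx : x ∈ s) (hy : y ∈ s) (hf' : HasFDerivAt f f' x) :
    f x + f' (y - x) ≤ f y := by
  have hconv : ConvexOn ℝ (AffineMap.lineMap x y ⁻¹' s) (f ∘ AffineMap.lineMap x y) :=
    hf.comp_affineMap (AffineMap.lineMap (k := ℝ) x y)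
  have hderiv : HasDerivAt (f ∘ AffineMap.lineMap (k := ℝ) x y) (f' (y - x)) 0 :=
    HasFDerivAt.comp_hasDerivAt (0 : ℝ) (by simpa using hf') AffineMap.hasDerivAt_lineMap
  have h := hconv.le_slope_of_hasDerivAt (x := 0) (y := 1) (by simpa using hx)
    (by simpa using hy) one_pos hderiv
  simp only [slope_def_field, Function.comp_apply, AffineMap.lineMap_apply_zero,
    AffineMap.lineMap_apply_one, sub_zero, div_one] at h
  linarith

/-- The tangent line inequality for `x ↦ x ^ q` on the nonnegative reals. -/
theorem Real.rpow_add_mul_rpow_sub_one_mul_sub_le {q a b : ℝ} (hq : 1 ≤ q) (ha : 0 ≤ a)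
    (hb : 0 ≤ b) : a ^ q + q * a ^ (q - 1) * (b - a) ≤ b ^ q := by
  have h := (convexOn_rpow hq).add_hasFDerivAt_apply_sub_le ha hb
    (Real.hasDerivAt_rpow_const (Or.inr hq)).hasFDerivAt
  simp only [ContinuousLinearMap.toSpanSingleton_apply, smul_eq_mul] at h
  linarith

/-- Clarkson-type inequality obtained by raising a midpoint inequality to a power `q ≥ 1`. -/
theorem Real.two_mul_rpow_add_rpow_le_of_add_le_midpoint {q a b m d : ℝ} (hq : 1 ≤ q)
    (ha : 0 ≤ a) (hb : 0 ≤ b) (hm : 0 ≤ m) (hd : 0 ≤ d) (h : m + d ≤ (a + b) / 2) :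
    2 * (m ^ q + d ^ q) ≤ a ^ q + b ^ q := by
  have hsup : m ^ q + d ^ q ≤ (m + d) ^ q := Real.add_rpow_le_rpow_add hm hd hq
  have hmono : (m + d) ^ q ≤ ((a + b) / 2) ^ q :=
    Real.rpow_le_rpow (add_nonneg hm hd) h (by linarith)
  have hconv := (convexOn_rpow hq).2 (Set.mem_Ici.2 ha) (Set.mem_Ici.2 hb)
    (one_half_pos (α := ℝ)).le (one_half_pos (α := ℝ)).le (add_halves 1)
  simp only [smul_eq_mul] at hconv
  rw [show 1 / 2 * a + 1 / 2 * b = (a + b) / 2 by ring] at hconv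
  linarith


/-- Minkowski-space form of Lemma 3.1: if `F` is a continuous nonnegative
positively 1-homogeneous function on a finite-dimensional real vector space,
differentiable away from `0`, whose square is 2-uniformly convex with constant
`l ∈ [0,1]`, then for `p ≥ 2`, `ξ ≠ 0` and every `β`,
`F(β)^p ≥ F(ξ)^p + p F(ξ)^{p-2} D(½F²)(ξ)(β-ξ) + (l^{p/2}/2^{p-1}) F(β-ξ)^p`. -/
theorem minkowski_lindqvist_inequality
    {E : Type*} [NormedAddCommGroup E] [NormedSpace ℝ E] [FiniteDimensional ℝ E]
    (p : ℝ) (hp : 2 ≤ p)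
    (F : E → ℝ) (hFcont : Continuous F) (hFnonneg : ∀ y, 0 ≤ F y)
    (hFhom : ∀ (t : ℝ) (y : E), 0 ≤ t → F (t • y) = t * F y)
    (hFdiff : ∀ x : E, x ≠ 0 → DifferentiableAt ℝ F x)
    (l : ℝ) (hl0 : 0 ≤ l) (hl1 : l ≤ 1)
    (huc : ∀ (ξ β : E) (t : ℝ), 0 ≤ t → t ≤ 1 →
      F (t • ξ + (1 - t) • β) ^ 2 ≤
        t * F ξ ^ 2 + (1 - t) * F β ^ 2 - l * (t * (1 - t)) * F (β - ξ) ^ 2)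
    (ξ : E) (hξ : ξ ≠ 0) (β : E) :
    F β ^ p ≥
      F ξ ^ p
        + p * F ξ ^ (p - 2) * fderiv ℝ (fun y => (1 / 2 : ℝ) * F y ^ 2) ξ (β - ξ)
        + l ^ (p / 2) / 2 ^ (p - 1) * F (β - ξ) ^ p := by
  have hq : 1 ≤ p / 2 := by linarith
  have hpow (x r : ℝ) (hx : 0 ≤ x) : (x ^ 2) ^ (r / 2) = x ^ r := by
    rw [← Real.rpow_natCast, ← Real.rpow_mul hx]
    congr 1
    push_cast
    ring
  have hconv : ConvexOn ℝ Set.univ (fun y => (1 / 2 : ℝ) * F y ^ 2) := by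
    refine ⟨convex_univ, fun x _ y _ a b ha hb hab => ?_⟩
    obtain rfl : b = 1 - a := by linarith
    have h := huc x y a ha (by linarith)
    have hdef : 0 ≤ l * (a * (1 - a)) * F (y - x) ^ 2 := by positivity
    simp only [smul_eq_mul]
    linarith
  obtain ⟨m, hm⟩ : ∃ m : E, m = (1 / 2 : ℝ) • ξ + (1 - 1 / 2 : ℝ) • β := ⟨_, rfl⟩
  have hdiff : DifferentiableAt ℝ (fun y => (1 / 2 : ℝ) * F y ^ 2) ξ :=
    ((hFdiff ξ hξ).pow 2).const_mul (1 / 2 : ℝ)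
  have htangent := hconv.add_hasFDerivAt_apply_sub_le (Set.mem_univ ξ) (Set.mem_univ m)
    hdiff.hasFDerivAt
  have hsub : m - ξ = (1 / 2 : ℝ) • (β - ξ) := by
    rw [hm]
    module
  rw [hsub, map_smul, smul_eq_mul] at htangent
  set D := fderiv ℝ (fun y => (1 / 2 : ℝ) * F y ^ 2) ξ (β - ξ)
  have hbern := Real.rpow_add_mul_rpow_sub_one_mul_sub_le hq (sq_nonneg (F ξ)) (sq_nonneg (F m))
  rw [show p / 2 - 1 = (p - 2) / 2 by ring, hpow _ _ (hFnonneg ξ), hpow _ _ (hFnonneg ξ),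
    hpow _ _ (hFnonneg m)] at hbern
  have hcoef : 0 ≤ p / 2 * F ξ ^ (p - 2) :=
    mul_nonneg (by linarith) (Real.rpow_nonneg (hFnonneg ξ) _)
  have hslope : p / 2 * F ξ ^ (p - 2) * D ≤ p / 2 * F ξ ^ (p - 2) * (F m ^ 2 - F ξ ^ 2) :=
    mul_le_mul_of_nonneg_left (by linarith) hcoef
  have hmid := huc ξ β (1 / 2) (by norm_num) (by norm_num)
  rw [← hm] at hmid
  have hclarkson := Real.two_mul_rpow_add_rpow_le_of_add_le_midpoint hq (sq_nonneg (F ξ))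
    (sq_nonneg (F β)) (sq_nonneg (F m)) (d := l * (F (β - ξ) / 2) ^ 2) (by positivity)
    (by linarith)
  rw [hpow _ _ (hFnonneg ξ), hpow _ _ (hFnonneg β), hpow _ _ (hFnonneg m),
    Real.mul_rpow hl0 (sq_nonneg _), hpow _ _ (div_nonneg (hFnonneg _) two_pos.le),
    Real.div_rpow (hFnonneg _) two_pos.le] at hclarkson
  have hconst : l ^ (p / 2) / 2 ^ (p - 1) * F (β - ξ) ^ p
      = 2 * (l ^ (p / 2) * (F (β - ξ) ^ p / 2 ^ p)) := by
    rw [Real.rpow_sub_one two_ne_zero]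
    field_simp
  rw [hconst]
  linarith
end

section
/- Let E be a finite-dimensional real inner product space with inner product ⟨·,·⟩ and norm ‖·‖, let β ∈ E with ‖β‖ < 1, and define the Randers norm F(y) = ‖y‖ + ⟨β, y⟩ for y ∈ E. Then for all y, z ∈ E and all t ∈ [0, 1] one has F(t y + (1 − t) z)² ≤ t F(y)² + (1 − t) F(z)² − ((1 − ‖β‖)/(1 + ‖β‖))² · t(1 − t) · F(z − y)². -/
open RealInnerProductSpace

/-- The scalar inequality behind the strong convexity of the square of a Randers norm. -/
theorem randers_scalar_ineq {b k h g D : ℝ} (hb0 : 0 ≤ b) (hb1 : b ≤ 1) (hD : 0 ≤ D)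
    (hg : |g| ≤ b) (hh : h ^ 2 ≤ b ^ 2 * (k ^ 2 + D)) :
    (1 - b) ^ 2 * (k ^ 2 + D) ≤ (k + h) ^ 2 + (1 + g) * D := by
  obtain ⟨hg1, -⟩ := abs_le.mp hg
  rcases hb0.eq_or_lt with rfl | hb
  · have h0 : h = 0 := by nlinarith
    have hg0 : g = 0 := abs_nonpos_iff.mp hg
    subst h0 hg0
    linarith
  · have h1 : 0 ≤ b * (b + g) * D := mul_nonneg (mul_nonneg hb0 (by linarith)) hD
    have h2 : 0 ≤ (1 - b) * (b ^ 2 * (k ^ 2 + D) - h ^ 2) :=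
      mul_nonneg (by linarith) (by linarith)
    have h3 : 0 ≤ b * ((k + h) ^ 2 + (1 + g) * D - (1 - b) ^ 2 * (k ^ 2 + D)) := by
      nlinarith [sq_nonneg (b * k + h)]
    linarith [nonneg_of_mul_nonneg_right h3 hb]

/-- The square of a Randers norm lies above its tangent at `v` by at least
`(1 - ‖β‖)² ‖u - v‖²`. -/
theorem randers_sq_tangent_ineq {E : Type*} [NormedAddCommGroup E] [InnerProductSpace ℝ E]
    {β : E} (hβ : ‖β‖ ≤ 1) (u v : E) :
    (‖v‖ + ⟪β, v⟫) ^ 2 + 2 * (‖v‖ + ⟪β, v⟫) * ⟪‖v‖⁻¹ • v + β, u - v⟫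
      + (1 - ‖β‖) ^ 2 * ‖u - v‖ ^ 2 ≤ (‖u‖ + ⟪β, u⟫) ^ 2 := by
  obtain ⟨e, he⟩ : ∃ e, e = ‖v‖⁻¹ • v := ⟨_, rfl⟩
  rw [← he]
  have hse : ‖v‖ • e = v := by
    rcases eq_or_ne v 0 with rfl | hv
    · simp
    · rw [he, smul_inv_smul₀ (norm_ne_zero_iff.mpr hv)]
  have hen : ‖e‖ ≤ 1 := by
    rw [he, norm_smul, norm_inv, norm_norm]
    exact inv_mul_le_one
  have hev : ⟪e, v⟫ = ‖v‖ := by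
    rw [he, real_inner_smul_left, real_inner_self_eq_norm_sq]
    rcases eq_or_ne ‖v‖ 0 with h | h
    · simp [h]
    · field_simp
  have hvu : ⟪u, v⟫ = ‖v‖ * ⟪e, u⟫ := by
    rw [← real_inner_smul_left, hse, real_inner_comm]
  have hβv : ⟪β, v⟫ = ‖v‖ * ⟪β, e⟫ := by
    rw [← real_inner_smul_right, hse]
  have hg : |⟪β, e⟫| ≤ ‖β‖ :=
    (abs_real_inner_le_norm β e).trans (mul_le_of_le_one_right (norm_nonneg _) hen)
  have heu : ⟪e, u⟫ ≤ ‖u‖ :=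
    (real_inner_le_norm e u).trans (mul_le_of_le_one_left (norm_nonneg _) hen)
  have hN : ‖u - v‖ ^ 2 = (‖u‖ - ‖v‖) ^ 2 + 2 * ‖v‖ * (‖u‖ - ⟪e, u⟫) := by
    rw [norm_sub_sq_real, hvu]
    ring
  have hh : ⟪β, u - v⟫ ^ 2 ≤ ‖β‖ ^ 2 * ‖u - v‖ ^ 2 := by
    rw [← mul_pow, ← sq_abs]
    exact pow_le_pow_left₀ (abs_nonneg _) (abs_real_inner_le_norm _ _) 2
  rw [hN] at hh
  have key := randers_scalar_ineq (norm_nonneg β) hβ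
    (mul_nonneg (mul_nonneg zero_le_two (norm_nonneg v)) (sub_nonneg.mpr heu)) hg hh
  rw [hN]
  rw [inner_sub_right, hβv] at key
  rw [inner_add_left, inner_sub_right, inner_sub_right, hev, hβv]
  linarith

/-- 2-uniform convexity of the square of a Randers norm
`F(y) = ‖y‖ + ⟨β, y⟩` with `‖β‖ < 1`, with the uniformity constant
`((1 - ‖β‖)/(1 + ‖β‖))²`. -/
theorem randers_two_uniform_convexity
    {E : Type*} [NormedAddCommGroup E] [InnerProductSpace ℝ E] [FiniteDimensional ℝ E]
    (β : E) (hβ : ‖β‖ < 1) (F : E → ℝ) (hF : ∀ y, F y = ‖y‖ + ⟪β, y⟫)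
    (y z : E) (t : ℝ) (ht0 : 0 ≤ t) (ht1 : t ≤ 1) :
    F (t • y + (1 - t) • z) ^ 2 ≤
      t * F y ^ 2 + (1 - t) * F z ^ 2
        - ((1 - ‖β‖) / (1 + ‖β‖)) ^ 2 * (t * (1 - t)) * F (z - y) ^ 2 := by
  have hw : ((1 - ‖β‖) / (1 + ‖β‖)) ^ 2 * F (z - y) ^ 2 ≤ (1 - ‖β‖) ^ 2 * ‖z - y‖ ^ 2 := by
    have hpos : 0 < 1 + ‖β‖ := by positivity
    have habs := abs_le.mp (abs_real_inner_le_norm β (z - y))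
    have hle : F (z - y) ^ 2 ≤ ((1 + ‖β‖) * ‖z - y‖) ^ 2 := by
      have hβn := mul_le_of_le_one_left (norm_nonneg (z - y)) hβ.le
      rw [hF]
      exact pow_le_pow_left₀ (by linarith) (by linarith) 2
    calc _ ≤ ((1 - ‖β‖) / (1 + ‖β‖)) ^ 2 * ((1 + ‖β‖) * ‖z - y‖) ^ 2 := by gcongr
      _ = _ := by field_simp
  obtain ⟨v, hv⟩ : ∃ v, v = t • y + (1 - t) • z := ⟨_, rfl⟩
  have hyv : y - v = (-(1 - t)) • (z - y) := by rw [hv]; module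
  have hzv : z - v = t • (z - y) := by rw [hv]; module
  have hy := randers_sq_tangent_ineq hβ.le y v
  have hz := randers_sq_tangent_ineq hβ.le z v
  rw [← hF, ← hF, hyv, real_inner_smul_right, norm_smul, mul_pow, Real.norm_eq_abs, sq_abs] at hy
  rw [← hF, ← hF, hzv, real_inner_smul_right, norm_smul, mul_pow, Real.norm_eq_abs, sq_abs] at hz
  rw [← hv]
  have h1 := mul_le_mul_of_nonneg_left hy ht0
  have h2 := mul_le_mul_of_nonneg_left hz (sub_nonneg.mpr ht1)
  have h3 := mul_le_mul_of_nonneg_left hw (mul_nonneg ht0 (sub_nonneg.mpr ht1))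
  linarith
end

section
/- Let E be a finite-dimensional real inner product space with inner product ⟨·,·⟩ and norm ‖·‖, let β ∈ E with ‖β‖ < 1, and define the Randers norm F(y) = ‖y‖ + ⟨β, y⟩ for y ∈ E. Then for every ξ ∈ E, the polar transform F*(ξ) := sup over y ∈ E ∖ {0} of ⟨ξ, y⟩ / F(y) satisfies F*(ξ) = (√(⟨ξ, β⟩² + (1 − ‖β‖²)‖ξ‖²) − ⟨ξ, β⟩) / (1 − ‖β‖²). -/
open RealInnerProductSpace

/-- The Randers norm is positive away from the origin. -/
lemma norm_add_inner_pos {E : Type*} [NormedAddCommGroup E] [InnerProductSpace ℝ E]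
    {β y : E} (hβ : ‖β‖ < 1) (hy : y ≠ 0) : 0 < ‖y‖ + ⟪β, y⟫ := by
  have hy' : 0 < ‖y‖ := norm_pos_iff.mpr hy
  have h := neg_le_of_abs_le (abs_real_inner_le_norm β y)
  nlinarith

/-- If `M` is the norm of `ξ - M • β`, then `M` is the supremum of `⟨ξ, y⟩ / (‖y‖ + ⟨β, y⟩)`. -/
lemma sSup_inner_div_norm_add_inner {E : Type*} [NormedAddCommGroup E] [InnerProductSpace ℝ E]
    {β ξ : E} (hβ : ‖β‖ < 1) {M : ℝ} (hM : ‖ξ - M • β‖ = M) :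
    sSup {r : ℝ | ∃ y : E, y ≠ 0 ∧ r = ⟪ξ, y⟫ / (‖y‖ + ⟪β, y⟫)} = M := by
  have inner_eq (y : E) : ⟪ξ - M • β, y⟫ = ⟪ξ, y⟫ - M * ⟪β, y⟫ := by
    rw [inner_sub_left, real_inner_smul_left]
  have upper : ∀ r ∈ {r : ℝ | ∃ y : E, y ≠ 0 ∧ r = ⟪ξ, y⟫ / (‖y‖ + ⟪β, y⟫)}, r ≤ M := by
    rintro r ⟨y, hy, rfl⟩
    rw [div_le_iff₀ (norm_add_inner_pos hβ hy)]
    have h := real_inner_le_norm (ξ - M • β) y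
    rw [inner_eq, hM] at h
    linarith
  by_cases hξ : ξ - M • β = 0
  · have hM0 : M = 0 := by rw [← hM, hξ, norm_zero]
    have hξ0 : ξ = 0 := by simpa [hM0] using hξ
    subst hM0 hξ0
    refine le_antisymm (Real.sSup_le upper le_rfl) (Real.sSup_nonneg ?_)
    rintro r ⟨y, -, rfl⟩
    simp
  · refine IsGreatest.csSup_eq ⟨⟨ξ - M • β, hξ, ?_⟩, upper⟩
    rw [eq_div_iff (norm_add_inner_pos hβ hξ).ne']
    have h := inner_eq (ξ - M • β)
    rw [real_inner_self_eq_norm_sq, hM] at h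
    rw [hM]
    linarith

/-- Explicit formula for the polar transform of the Randers norm
`F(y) = ‖y‖ + ⟨β, y⟩` with `‖β‖ < 1`:
`F*(ξ) = (√(⟨ξ,β⟩² + (1 - ‖β‖²)‖ξ‖²) - ⟨ξ,β⟩)/(1 - ‖β‖²)`. -/
theorem randers_polar_transform_formula
    {E : Type*} [NormedAddCommGroup E] [InnerProductSpace ℝ E] [FiniteDimensional ℝ E]
    (β : E) (hβ : ‖β‖ < 1) (F : E → ℝ) (hF : ∀ y, F y = ‖y‖ + ⟪β, y⟫) (ξ : E) :
    sSup {r : ℝ | ∃ y : E, y ≠ 0 ∧ r = ⟪ξ, y⟫ / F y} =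
      (Real.sqrt (⟪ξ, β⟫ ^ 2 + (1 - ‖β‖ ^ 2) * ‖ξ‖ ^ 2) - ⟪ξ, β⟫) / (1 - ‖β‖ ^ 2) := by
  simp only [hF]
  apply sSup_inner_div_norm_add_inner hβ
  have hb : 0 < 1 - ‖β‖ ^ 2 := by nlinarith [norm_nonneg β]
  have hd : 0 ≤ (1 - ‖β‖ ^ 2) * ‖ξ‖ ^ 2 := by positivity
  set s := Real.sqrt (⟪ξ, β⟫ ^ 2 + (1 - ‖β‖ ^ 2) * ‖ξ‖ ^ 2)
  have hs_sq : s ^ 2 = ⟪ξ, β⟫ ^ 2 + (1 - ‖β‖ ^ 2) * ‖ξ‖ ^ 2 :=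
    Real.sq_sqrt (by positivity)
  have hs_ge : ⟪ξ, β⟫ ≤ s := Real.le_sqrt_of_sq_le (by linarith)
  set M := (s - ⟪ξ, β⟫) / (1 - ‖β‖ ^ 2)
  have hM_nonneg : 0 ≤ M := div_nonneg (sub_nonneg.mpr hs_ge) hb.le
  have hM_mul : M * (1 - ‖β‖ ^ 2) = s - ⟪ξ, β⟫ := div_mul_cancel₀ _ hb.ne'
  have quadratic : (1 - ‖β‖ ^ 2) * M ^ 2 + 2 * ⟪ξ, β⟫ * M - ‖ξ‖ ^ 2 = 0 := by
    apply mul_left_cancel₀ hb.ne'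
    linear_combination (M * (1 - ‖β‖ ^ 2) + s + ⟪ξ, β⟫) * hM_mul + hs_sq
  rw [← sq_eq_sq₀ (norm_nonneg _) hM_nonneg, norm_sub_sq_real, real_inner_smul_right, norm_smul,
    mul_pow, Real.norm_eq_abs, sq_abs]
  linear_combination -quadratic
end

section
/- Let (X, μ) be a measure space, let p ≥ 2 be a real number, and let u, v : X → ℝ be measurable functions with ∫|u|^p dμ < ∞ and ∫|v|^p dμ < ∞. Then ∫|v|^p dμ − ∫|u|^p dμ ≥ p·∫ |u|^{p−2} u (v − u) dμ + 2^{1−p}·∫ |v − u|^p dμ. -/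
open MeasureTheory

/-- Tangent line inequality for `t ↦ |t| ^ p`. -/
lemma abs_rpow_tangent_le {p : ℝ} (hp : 2 ≤ p) (a c : ℝ) :
    |a| ^ p + p * (|a| ^ (p - 2) * a * (c - a)) ≤ |c| ^ p := by
  rcases eq_or_ne a 0 with rfl | ha
  · have h0 : (0 : ℝ) ^ p = 0 := Real.zero_rpow (by linarith)
    simpa [h0] using Real.rpow_nonneg (abs_nonneg c) p
  have hpos : 0 < |a| := abs_pos.mpr ha
  have hbern := one_add_mul_self_le_rpow_one_add (s := |c| / |a| - 1)
    (by have : 0 ≤ |c| / |a| := by positivity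
        linarith) (p := p) (by linarith)
  rw [add_sub_cancel, Real.div_rpow (abs_nonneg c) hpos.le,
    le_div_iff₀ (Real.rpow_pos_of_pos hpos p)] at hbern
  have hsplit : |a| ^ p = |a| ^ (p - 2) * |a| ^ 2 := by
    rw [← Real.rpow_natCast, ← Real.rpow_add hpos]
    norm_num
  have hac : a * (c - a) ≤ |a| * |c| - |a| ^ 2 := by
    have := le_abs_self (a * c)
    rw [abs_mul] at this
    rw [sq_abs]
    linarith
  have hmul : |a| ^ (p - 2) * (a * (c - a)) ≤ |a| ^ (p - 2) * (|a| * |c| - |a| ^ 2) :=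
    mul_le_mul_of_nonneg_left hac (by positivity)
  have heq : (1 + p * (|c| / |a| - 1)) * |a| ^ p
      = |a| ^ p + p * (|a| ^ (p - 2) * (|a| * |c| - |a| ^ 2)) := by
    rw [hsplit]
    field_simp
  have := mul_le_mul_of_nonneg_left hmul (by linarith : (0 : ℝ) ≤ p)
  rw [mul_assoc]
  linarith

/-- Scalar Clarkson inequality. -/
lemma abs_rpow_clarkson {p : ℝ} (hp : 2 ≤ p) (a b : ℝ) :
    |(a + b) / 2| ^ p + |(b - a) / 2| ^ p ≤ (|a| ^ p + |b| ^ p) / 2 := by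
  have hq : 1 ≤ p / 2 := by linarith
  have hsq (x : ℝ) : |x| ^ p = (x ^ 2) ^ (p / 2) := by
    rw [← sq_abs, ← Real.rpow_natCast, ← Real.rpow_mul (abs_nonneg x)]
    congr 1
    push_cast
    ring
  simp only [hsq]
  refine (Real.add_rpow_le_rpow_add (sq_nonneg _) (sq_nonneg _) hq).trans ?_
  have h := (convexOn_rpow hq).2 (Set.mem_Ici.mpr (sq_nonneg a)) (Set.mem_Ici.mpr (sq_nonneg b))
    (by norm_num : (0 : ℝ) ≤ 1 / 2) (by norm_num : (0 : ℝ) ≤ 1 / 2) (by norm_num)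
  simp only [smul_eq_mul] at h
  have e : ((a + b) / 2) ^ 2 + ((b - a) / 2) ^ 2 = 1 / 2 * a ^ 2 + 1 / 2 * b ^ 2 := by ring
  rw [e]
  linarith

/-- Scalar Lindqvist inequality. -/
lemma abs_rpow_lindqvist {p : ℝ} (hp : 2 ≤ p) (a b : ℝ) :
    p * (|a| ^ (p - 2) * a * (b - a)) + (2 : ℝ) ^ (1 - p) * |b - a| ^ p ≤ |b| ^ p - |a| ^ p := by
  have h1 := abs_rpow_tangent_le hp a ((a + b) / 2)
  have h2 := abs_rpow_clarkson hp a b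
  have h3 : |(b - a) / 2| ^ p = (2 : ℝ) ^ (1 - p) * |b - a| ^ p / 2 := by
    rw [abs_div, Real.div_rpow (abs_nonneg _) (abs_nonneg _), Real.rpow_sub two_pos, abs_two,
      Real.rpow_one]
    field_simp
  have h4 : p * (|a| ^ (p - 2) * a * ((a + b) / 2 - a))
      = p * (|a| ^ (p - 2) * a * (b - a)) / 2 := by ring
  linarith

lemma max_abs_rpow_le_add (p a b : ℝ) : max |a| |b| ^ p ≤ |a| ^ p + |b| ^ p := by
  have ha : 0 ≤ |a| ^ p := by positivity
  have hb : 0 ≤ |b| ^ p := by positivity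
  rcases max_choice |a| |b| with h | h <;> rw [h] <;> linarith

lemma abs_sub_le_two_mul_max_abs (a b : ℝ) : |b - a| ≤ 2 * max |a| |b| := by
  have := abs_sub b a
  linarith [le_max_left |a| |b|, le_max_right |a| |b|]

lemma abs_sub_rpow_le {p : ℝ} (hp : 0 ≤ p) (a b : ℝ) :
    |b - a| ^ p ≤ 2 ^ p * (|a| ^ p + |b| ^ p) := by
  have hM : 0 ≤ max |a| |b| := (abs_nonneg a).trans (le_max_left _ _)
  calc |b - a| ^ p ≤ (2 * max |a| |b|) ^ p :=
        Real.rpow_le_rpow (abs_nonneg _) (abs_sub_le_two_mul_max_abs a b) hp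
    _ = 2 ^ p * max |a| |b| ^ p := Real.mul_rpow two_pos.le hM
    _ ≤ _ := by gcongr; exact max_abs_rpow_le_add p a b

lemma abs_rpow_sub_two_mul_mul_sub_le {p : ℝ} (hp : 2 ≤ p) (a b : ℝ) :
    |(|a| ^ (p - 2) * a * (b - a))| ≤ 2 * (|a| ^ p + |b| ^ p) := by
  have hM : 0 ≤ max |a| |b| := (abs_nonneg a).trans (le_max_left _ _)
  have hsplit : max |a| |b| ^ p = max |a| |b| ^ (p - 2) * max |a| |b| ^ 2 := by
    rw [← Real.rpow_natCast, ← Real.rpow_add_of_nonneg hM (by linarith) (by norm_num)]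
    norm_num
  rw [abs_mul, abs_mul, abs_of_nonneg (Real.rpow_nonneg (abs_nonneg a) (p - 2))]
  calc |a| ^ (p - 2) * |a| * |b - a|
      ≤ max |a| |b| ^ (p - 2) * max |a| |b| * (2 * max |a| |b|) := by
        gcongr
        · exact le_max_left _ _
        · exact le_max_left _ _
        · exact abs_sub_le_two_mul_max_abs a b
    _ = 2 * max |a| |b| ^ p := by rw [hsplit]; ring
    _ ≤ _ := by gcongr; exact max_abs_rpow_le_add p a b

lemma integrable_abs_rpow_of_lintegral_lt_top {X : Type*} [MeasurableSpace X] {μ : Measure X}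
    {p : ℝ} {u : X → ℝ} (hu : Measurable u)
    (hui : ∫⁻ x, ENNReal.ofReal (|u x| ^ p) ∂μ < ⊤) : Integrable (fun x => |u x| ^ p) μ := by
  refine ⟨(hu.abs.pow_const p).aestronglyMeasurable, ?_⟩
  rwa [hasFiniteIntegral_iff_ofReal (.of_forall fun x => by positivity)]

/-- Integrated form of the Lindqvist inequality: for `p ≥ 2` and `p`-integrable
measurable real functions `u, v` on a measure space,
`∫|v|^p - ∫|u|^p ≥ p ∫ |u|^{p-2} u (v - u) + 2^{1-p} ∫ |v - u|^p`. -/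
theorem lindqvist_integral_inequality
    {X : Type*} [MeasurableSpace X] (μ : Measure X) (p : ℝ) (hp : 2 ≤ p)
    (u v : X → ℝ) (hu : Measurable u) (hv : Measurable v)
    (hui : ∫⁻ x, ENNReal.ofReal (|u x| ^ p) ∂μ < ⊤)
    (hvi : ∫⁻ x, ENNReal.ofReal (|v x| ^ p) ∂μ < ⊤) :
    (∫ x, |v x| ^ p ∂μ) - ∫ x, |u x| ^ p ∂μ ≥
      p * ∫ x, |u x| ^ (p - 2) * u x * (v x - u x) ∂μ
        + (2 : ℝ) ^ (1 - p) * ∫ x, |v x - u x| ^ p ∂μ := by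
  have hU := integrable_abs_rpow_of_lintegral_lt_top hu hui
  have hV := integrable_abs_rpow_of_lintegral_lt_top hv hvi
  have hD : Integrable (fun x => |v x - u x| ^ p) μ := by
    refine ((hU.add hV).const_mul (2 ^ p)).mono'
      ((hv.sub hu).abs.pow_const p).aestronglyMeasurable (.of_forall fun x => ?_)
    rw [Real.norm_of_nonneg (by positivity)]
    exact abs_sub_rpow_le (by linarith) (u x) (v x)
  have hP : Integrable (fun x => |u x| ^ (p - 2) * u x * (v x - u x)) μ :=
    ((hU.add hV).const_mul 2).mono'
      (((hu.abs.pow_const (p - 2)).mul hu).mul (hv.sub hu)).aestronglyMeasurable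
      (.of_forall fun x => abs_rpow_sub_two_mul_mul_sub_le hp (u x) (v x))
  rw [ge_iff_le, ← integral_sub hV hU, ← integral_const_mul, ← integral_const_mul,
    ← integral_add (hP.const_mul p) (hD.const_mul _)]
  exact integral_mono ((hP.const_mul p).add (hD.const_mul _)) (hV.sub hU)
    fun x => abs_rpow_lindqvist hp (u x) (v x)
end

section
/- Let d ≥ 3 be an integer and let p > 1, a, b be real numbers with d + a − p > 0 and b + p > 0. Then for every smooth compactly supported function u : ℝ^d → ℝ one has ∫_{ℝ^d} ‖x‖^a |u(x)|^b ‖∇u(x)‖^p dx ≥ ((a + d − p)/(b + p))^p · ∫_{ℝ^d} ‖x‖^{a−p} |u(x)|^{p+b} dx, where ‖·‖ is the Euclidean norm and both integrals are taken in [0, +∞]. -/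
open MeasureTheory

open Set in
/-- Integration in polar coordinates for the lower Lebesgue integral. -/
lemma lintegral_eq_lintegral_toSphere {E : Type*} [NormedAddCommGroup E] [NormedSpace ℝ E]
    [MeasurableSpace E] [BorelSpace E] [FiniteDimensional ℝ E] [Nontrivial E]
    (μ : Measure E) [μ.IsAddHaarMeasure] {f : E → ENNReal} (hf : Measurable f) :
    ∫⁻ x, f x ∂μ = ∫⁻ ω : Metric.sphere (0 : E) 1, (∫⁻ r in Ioi (0 : ℝ),
      ENNReal.ofReal (r ^ (Module.finrank ℝ E - 1)) * f (r • (ω : E))) ∂μ.toSphere := by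
  have hsymm : ∀ x : ({0}ᶜ : Set E),
      f x = (fun y : Metric.sphere (0 : E) 1 × Ioi (0 : ℝ) ↦ f (y.2.1 • y.1.1))
        (homeomorphUnitSphereProd E x) := fun x ↦ by
    have : ((homeomorphUnitSphereProd E).symm (homeomorphUnitSphereProd E x) : E) = x := by simp
    rw [homeomorphUnitSphereProd_symm_apply_coe] at this
    simp only [this]
  have hm : Measurable (fun y : Metric.sphere (0 : E) 1 × Ioi (0 : ℝ) ↦ f (y.2.1 • y.1.1)) :=
    hf.comp (by fun_prop)
  calc ∫⁻ x, f x ∂μ = ∫⁻ x in {(0 : E)}ᶜ, f x ∂μ := by rw [restrict_compl_singleton]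
    _ = ∫⁻ x : ({(0)}ᶜ : Set E), f x ∂(μ.comap (↑)) :=
      (lintegral_subtype_comap (measurableSet_singleton _).compl f).symm
    _ = ∫⁻ y, f (y.2.1 • y.1.1) ∂(μ.toSphere.prod (.volumeIoiPow (Module.finrank ℝ E - 1))) := by
      rw [lintegral_congr hsymm,
        μ.measurePreserving_homeomorphUnitSphereProd.lintegral_comp hm]
    _ = ∫⁻ ω, ∫⁻ r, f (r.1 • ω.1) ∂(.volumeIoiPow (Module.finrank ℝ E - 1)) ∂μ.toSphere :=
      lintegral_prod _ hm.aemeasurable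
    _ = _ := by
      refine lintegral_congr fun ω ↦ ?_
      have hm' : Measurable (fun r : Ioi (0 : ℝ) ↦ f (r.1 • ω.1)) := hf.comp (by fun_prop)
      rw [Measure.volumeIoiPow, lintegral_withDensity_eq_lintegral_mul _ (by fun_prop) hm']
      exact lintegral_subtype_comap measurableSet_Ioi fun r : ℝ ↦
        ENNReal.ofReal (r ^ (Module.finrank ℝ E - 1)) * f (r • (ω : E))

open Set Filter Topology in
/-- If `v` is `C¹` and vanishes far to the right, then `|v| ^ q` at a point is controlled by the
integral to the right of that point of any function dominating `|(|v| ^ q)'|` where `v ≠ 0`. -/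
lemma ofReal_abs_rpow_le_lintegral_Ioi {v : ℝ → ℝ} (hv : ContDiff ℝ 1 v) {R : ℝ}
    (hR : ∀ r, R ≤ r → v r = 0) {q : ℝ} (hq : 0 < q) {h : ℝ → ENNReal}
    (hh : ∀ x, v x ≠ 0 → ENNReal.ofReal (q * |v x| ^ (q - 1) * |deriv v x|) ≤ h x) (r : ℝ) :
    ENNReal.ofReal (|v r| ^ q) ≤ ∫⁻ s in Ioi r, h s := by
  by_cases hr : v r = 0
  · simp [hr, Real.zero_rpow hq.ne']
  set S := {s | r ≤ s ∧ v s = 0} with hS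
  have hSc : IsClosed S := isClosed_Ici.inter (isClosed_eq hv.continuous continuous_const)
  have hSne : S.Nonempty := ⟨max r R, le_max_left _ _, hR _ (le_max_right _ _)⟩
  have hSb : BddBelow S := ⟨r, fun s hs ↦ hs.1⟩
  obtain ⟨hrs, hs⟩ := hSc.csInf_mem hSne hSb
  set s₀ := sInf S
  have hlt : r < s₀ := lt_of_le_of_ne hrs fun e ↦ hr (e ▸ hs)
  have hne : ∀ x, r ≤ x → x < s₀ → v x ≠ 0 := fun x hx hx' h0 ↦
    (csInf_le hSb ⟨hx, h0⟩).not_gt hx'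
  set g : ℝ → ℝ := fun x ↦ (v x ^ 2) ^ (q / 2) with hg
  have hgabs : ∀ x, g x = |v x| ^ q := fun x ↦ by
    rw [hg]
    simp only
    rw [← sq_abs, ← Real.rpow_natCast, ← Real.rpow_mul (abs_nonneg _)]
    congr 1
    push_cast
    ring
  have key : ∀ t, r < t → t < s₀ → ENNReal.ofReal (g r - g t) ≤ ∫⁻ s in Ioi r, h s := by
    intro t hrt hts
    set g' : ℝ → ℝ := fun x ↦ (2 * v x * deriv v x) * (q / 2) * (v x ^ 2) ^ (q / 2 - 1) with hg'
    have hmem : ∀ x ∈ uIcc r t, v x ≠ 0 := fun x hx ↦ by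
      rw [uIcc_of_le hrt.le] at hx
      exact hne x hx.1 (hx.2.trans_lt hts)
    have hderiv : ∀ x ∈ uIcc r t, HasDerivAt g (g' x) x := fun x hx ↦ by
      have h1 : HasDerivAt v (deriv v x) x :=
        (hv.differentiable (by simp) x).hasDerivAt
      have := (h1.pow 2).rpow_const (p := q / 2) (Or.inl (pow_ne_zero 2 (hmem x hx)))
      simpa [g, g'] using this
    have hcont : ContinuousOn g' (uIcc r t) := by
      have h2 : Continuous (deriv v) := hv.continuous_deriv (by simp)
      have h3 := hv.continuous
      refine ContinuousOn.mul (by fun_prop) (ContinuousOn.rpow_const (by fun_prop) fun x hx ↦ ?_)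
      exact Or.inl (pow_ne_zero 2 (hmem x hx))
    have hftc := intervalIntegral.integral_eq_sub_of_hasDerivAt hderiv hcont.intervalIntegrable
    calc ENNReal.ofReal (g r - g t) ≤ ‖∫ x in r..t, g' x‖ₑ := by
          rw [hftc, Real.enorm_eq_ofReal_abs, abs_sub_comm]
          exact ENNReal.ofReal_le_ofReal (le_abs_self _)
      _ ≤ ∫⁻ x in Ioc r t, ‖g' x‖ₑ := by
          rw [intervalIntegral.integral_of_le hrt.le]
          exact enorm_integral_le_lintegral_enorm _
      _ ≤ ∫⁻ x in Ioc r t, h x := by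
          refine setLIntegral_mono' measurableSet_Ioc fun x hx ↦ ?_
          have hx0 := hne x hx.1.le (hx.2.trans_lt hts)
          refine le_trans (le_of_eq ?_) (hh x hx0)
          rw [Real.enorm_eq_ofReal_abs]
          congr 1
          have hp : 0 < |v x| := abs_pos.2 hx0
          simp only [hg', abs_mul, abs_of_pos (half_pos hq), abs_two]
          rw [abs_of_nonneg (Real.rpow_nonneg (sq_nonneg _) _), ← sq_abs, ← Real.rpow_natCast,
            ← Real.rpow_mul hp.le, show q - 1 = 1 + ((2 : ℕ) : ℝ) * (q / 2 - 1) by push_cast; ring,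
            Real.rpow_add hp, Real.rpow_one]
          ring
      _ ≤ ∫⁻ x in Ioi r, h x := lintegral_mono_set Ioc_subset_Ioi_self
  have hgc : Continuous g := by
    have h3 := hv.continuous
    exact Continuous.rpow_const (by fun_prop) fun x ↦ Or.inr (by positivity)
  have hg0 : g s₀ = 0 := by rw [hgabs, hs, abs_zero, Real.zero_rpow hq.ne']
  have hlim : Tendsto (fun t ↦ ENNReal.ofReal (g r - g t)) (𝓝[<] s₀)
      (𝓝 (ENNReal.ofReal (g r - g s₀))) :=
    ((ENNReal.continuous_ofReal.comp (continuous_const.sub hgc)).tendsto s₀).mono_left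
      nhdsWithin_le_nhds
  rw [← hgabs, ← sub_zero (g r), ← hg0]
  refine le_of_tendsto hlim ?_
  filter_upwards [Ioo_mem_nhdsLT hlt] with t ht using key t ht.1 ht.2

open Set in
/-- The lower integral of `r ^ (c - 1)` over `(0, s)`. -/
lemma setLIntegral_Ioo_rpow {c : ℝ} (hc : 0 < c) {s : ℝ} (hs : 0 < s) :
    ∫⁻ r in Ioo 0 s, ENNReal.ofReal r ^ (c - 1) = ENNReal.ofReal (s ^ c / c) := by
  have hi : IntervalIntegrable (fun r : ℝ ↦ r ^ (c - 1)) volume 0 s :=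
    intervalIntegral.intervalIntegrable_rpow' (by linarith)
  rw [setLIntegral_congr_fun measurableSet_Ioo
      (g := fun r ↦ ENNReal.ofReal (r ^ (c - 1)))
      fun r hr ↦ ENNReal.ofReal_rpow_of_pos hr.1,
    Measure.restrict_congr_set Ioo_ae_eq_Ioc, ← ofReal_integral_eq_lintegral_ofReal hi.1,
    ← intervalIntegral.integral_of_le hs.le, integral_rpow (Or.inl (by linarith))]
  · simp [Real.zero_rpow hc.ne']
  · filter_upwards [ae_restrict_mem measurableSet_Ioc] with y hy
    exact Real.rpow_nonneg hy.1.le _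

open Set in
/-- Exchanging the order of integration in a weighted integral of tails. -/
lemma lintegral_Ioi_rpow_mul_lintegral_Ioi {c : ℝ} (hc : 0 < c) {h : ℝ → ENNReal}
    (hh : Measurable h) :
    ∫⁻ r in Ioi 0, ENNReal.ofReal r ^ (c - 1) * ∫⁻ s in Ioi r, h s =
      ENNReal.ofReal (1 / c) * ∫⁻ s in Ioi 0, ENNReal.ofReal s ^ c * h s := by
  have hmeas : Measurable (fun z : ℝ × ℝ ↦
      {z : ℝ × ℝ | 0 < z.1 ∧ z.1 < z.2}.indicator
        (fun z ↦ ENNReal.ofReal z.1 ^ (c - 1) * h z.2) z) := by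
    refine Measurable.indicator (by fun_prop) ?_
    exact (measurableSet_lt measurable_const measurable_fst).inter
      (measurableSet_lt measurable_fst measurable_snd)
  calc ∫⁻ r in Ioi 0, ENNReal.ofReal r ^ (c - 1) * ∫⁻ s in Ioi r, h s
      = ∫⁻ r, ∫⁻ s, {z : ℝ × ℝ | 0 < z.1 ∧ z.1 < z.2}.indicator
        (fun z ↦ ENNReal.ofReal z.1 ^ (c - 1) * h z.2) (r, s) := by
        rw [← lintegral_indicator measurableSet_Ioi]
        refine lintegral_congr fun r ↦ ?_
        by_cases hr : 0 < r
        · rw [indicator_of_mem (mem_Ioi.2 hr), ← lintegral_const_mul _ hh,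
            ← lintegral_indicator measurableSet_Ioi]
          refine lintegral_congr fun s ↦ ?_
          simp [indicator, hr]
        · simp [indicator, hr]
    _ = ∫⁻ s, ∫⁻ r, {z : ℝ × ℝ | 0 < z.1 ∧ z.1 < z.2}.indicator
        (fun z ↦ ENNReal.ofReal z.1 ^ (c - 1) * h z.2) (r, s) :=
        lintegral_lintegral_swap hmeas.aemeasurable
    _ = ∫⁻ s in Ioi 0, ENNReal.ofReal (1 / c) * (ENNReal.ofReal s ^ c * h s) := by
        rw [← lintegral_indicator measurableSet_Ioi]
        refine lintegral_congr fun s ↦ ?_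
        have e : ∀ r, {z : ℝ × ℝ | 0 < z.1 ∧ z.1 < z.2}.indicator
            (fun z ↦ ENNReal.ofReal z.1 ^ (c - 1) * h z.2) (r, s) =
            (Ioo 0 s).indicator (fun r ↦ ENNReal.ofReal r ^ (c - 1) * h s) r := fun r ↦ by
          simp [indicator]
        rw [lintegral_congr e, lintegral_indicator measurableSet_Ioo,
          lintegral_mul_const _ (by fun_prop)]
        by_cases hs : 0 < s
        · rw [indicator_of_mem (mem_Ioi.2 hs), setLIntegral_Ioo_rpow hc hs,
            ENNReal.ofReal_rpow_of_pos hs, ← mul_assoc, ← ENNReal.ofReal_mul (by positivity)]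
          congr 2
          ring
        · simp [hs]
    _ = _ := lintegral_const_mul _ (by fun_prop)

open Set in
/-- The weighted Hardy-type inequality on the half line. -/
lemma hardy_type_inequality_Ioi {v : ℝ → ℝ} (hv : ContDiff ℝ 1 v) {R : ℝ}
    (hR : ∀ r, R ≤ r → v r = 0) {p b c : ℝ} (hp : 1 < p) (hc : 0 < c) (hbp : 0 < b + p) :
    ENNReal.ofReal ((c / (b + p)) ^ p) *
        ∫⁻ r in Ioi 0, ENNReal.ofReal r ^ (c - 1) * ENNReal.ofReal |v r| ^ (p + b) ≤
      ∫⁻ r in Ioi 0, ENNReal.ofReal r ^ (c + p - 1) * ENNReal.ofReal |v r| ^ b *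
        ENNReal.ofReal |deriv v r| ^ p := by
  set I := ∫⁻ r in Ioi 0, ENNReal.ofReal r ^ (c - 1) * ENNReal.ofReal |v r| ^ (p + b) with hI
  set J := ∫⁻ r in Ioi 0, ENNReal.ofReal r ^ (c + p - 1) * ENNReal.ofReal |v r| ^ b *
        ENNReal.ofReal |deriv v r| ^ p with hJ
  have hp0 : 0 < p := by linarith
  have hq : 0 < p + b := by linarith
  have hvm : Measurable v := hv.continuous.measurable
  have hdm : Measurable (deriv v) := (hv.continuous_deriv (by simp)).measurable
  have hpq : p.HolderConjugate (p.conjExponent) := .conjExponent hp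
  set p' := p.conjExponent
  have hp' : 1 / p' = 1 - 1 / p := by
    have := hpq.inv_add_inv_eq_one
    rw [one_div, one_div]; linarith
  have hp'0 : 0 < p' := hpq.symm.pos
  -- finiteness of the right-hand side
  have hfin : I ≠ ⊤ := by
    obtain ⟨M, hM⟩ := (isCompact_Icc (a := (0 : ℝ)) (b := max R 1)).exists_bound_of_continuousOn
      hv.continuous.continuousOn
    have hle : I ≤ ∫⁻ r in Ioo 0 (max R 1),
        ENNReal.ofReal r ^ (c - 1) * ENNReal.ofReal M ^ (p + b) := by
      rw [hI, ← lintegral_indicator measurableSet_Ioi, ← lintegral_indicator measurableSet_Ioo]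
      refine lintegral_mono fun r ↦ ?_
      by_cases hr : 0 < r
      · by_cases hr' : r < max R 1
        · rw [indicator_of_mem (mem_Ioi.2 hr), indicator_of_mem (mem_Ioo.2 ⟨hr, hr'⟩)]
          gcongr
          exact hM r ⟨hr.le, hr'.le⟩
        · simp [indicator, hr, hR r ((le_max_left _ _).trans (not_lt.1 hr')), hq]
      · simp [indicator, hr]
    refine ne_top_of_le_ne_top ?_ hle
    rw [lintegral_mul_const _ (by fun_prop), setLIntegral_Ioo_rpow hc (by positivity)]
    exact ENNReal.mul_ne_top ENNReal.ofReal_ne_top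
      (ENNReal.rpow_ne_top_of_nonneg hq.le ENNReal.ofReal_ne_top)
  set F : ℝ → ENNReal := fun r ↦ ENNReal.ofReal |v r| ^ (b / p) * ENNReal.ofReal |deriv v r|
  set G : ℝ → ENNReal := fun r ↦ ENNReal.ofReal |v r| ^ ((p + b) / p')
  set f : ℝ → ENNReal := fun r ↦ ENNReal.ofReal r ^ ((c + p - 1) / p) * F r
  set g : ℝ → ENNReal := fun r ↦ ENNReal.ofReal r ^ ((c - 1) / p') * G r
  have hFm : Measurable F := by fun_prop
  have hGm : Measurable G := by fun_prop
  have hfm : Measurable f := by fun_prop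
  have hgm : Measurable g := by fun_prop
  have hpoint : ∀ x, v x ≠ 0 → ENNReal.ofReal ((p + b) * |v x| ^ (p + b - 1) * |deriv v x|) ≤
      ENNReal.ofReal (p + b) * (F x * G x) := fun x hx ↦ by
    have hx' : 0 < |v x| := abs_pos.2 hx
    have e : p + b - 1 = b / p + (p + b) / p' := by
      rw [div_eq_mul_one_div (p + b), hp']; field_simp; ring
    simp only [F, G]
    rw [mul_assoc, ENNReal.ofReal_mul hq.le, ENNReal.ofReal_mul (by positivity),
      ← ENNReal.ofReal_rpow_of_pos hx', e, ENNReal.rpow_add _ _ (by simpa using hx)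
        ENNReal.ofReal_ne_top]
    exact le_of_eq (by ring)
  have hIfg : I ≤ ENNReal.ofReal ((b + p) / c) * ∫⁻ r in Ioi 0, (f * g) r := by
    calc I ≤ ∫⁻ r in Ioi 0, ENNReal.ofReal r ^ (c - 1) *
            ∫⁻ s in Ioi r, ENNReal.ofReal (p + b) * (F s * G s) := by
          refine lintegral_mono fun r ↦ ?_
          gcongr
          rw [ENNReal.ofReal_rpow_of_nonneg (abs_nonneg _) hq.le]
          exact ofReal_abs_rpow_le_lintegral_Ioi hv hR hq hpoint r
      _ = ENNReal.ofReal (1 / c) * ∫⁻ s in Ioi 0, ENNReal.ofReal s ^ c *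
            (ENNReal.ofReal (p + b) * (F s * G s)) :=
          lintegral_Ioi_rpow_mul_lintegral_Ioi hc (by fun_prop)
      _ = ENNReal.ofReal (1 / c) * ∫⁻ s in Ioi 0, ENNReal.ofReal (p + b) * (f * g) s := by
          congr 1
          refine setLIntegral_congr_fun measurableSet_Ioi fun s hs ↦ ?_
          have e : c = (c + p - 1) / p + (c - 1) / p' := by
            rw [div_eq_mul_one_div (c - 1), hp']; field_simp; ring
          simp only [f, g, Pi.mul_apply]
          conv_lhs => rw [e]
          rw [ENNReal.rpow_add _ _ (by simpa using hs) ENNReal.ofReal_ne_top]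
          ring
      _ = _ := by
          rw [lintegral_const_mul _ (by fun_prop), ← mul_assoc,
            ← ENNReal.ofReal_mul (by positivity)]
          congr 2
          ring
  have hfp : ∫⁻ r in Ioi 0, f r ^ p = J := by
    refine lintegral_congr fun r ↦ ?_
    simp only [f, F]
    rw [ENNReal.mul_rpow_of_nonneg _ _ hp0.le, ENNReal.mul_rpow_of_nonneg _ _ hp0.le,
      ← ENNReal.rpow_mul, ← ENNReal.rpow_mul, div_mul_cancel₀ _ hp0.ne', div_mul_cancel₀ _ hp0.ne',
      mul_assoc]
  have hgp : ∫⁻ r in Ioi 0, g r ^ p' = I := by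
    refine lintegral_congr fun r ↦ ?_
    simp only [g, G]
    rw [ENNReal.mul_rpow_of_nonneg _ _ hp'0.le, ← ENNReal.rpow_mul, ← ENNReal.rpow_mul,
      div_mul_cancel₀ _ hp'0.ne', div_mul_cancel₀ _ hp'0.ne']
  have hholder := ENNReal.lintegral_mul_le_Lp_mul_Lq (volume.restrict (Ioi 0)) hpq
    hfm.aemeasurable hgm.aemeasurable
  rw [hfp, hgp] at hholder
  by_cases hI0 : I = 0
  · simp [hI0]
  have hroot : I ^ (1 / p) ≤ ENNReal.ofReal ((b + p) / c) * J ^ (1 / p) := by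
    have h1 : I ^ (1 / p) * I ^ (1 / p') ≤
        ENNReal.ofReal ((b + p) / c) * J ^ (1 / p) * I ^ (1 / p') := by
      rw [← ENNReal.rpow_add _ _ hI0 hfin, hp', add_sub_cancel, ENNReal.rpow_one, ← hp', mul_assoc]
      exact hIfg.trans (by gcongr)
    exact (ENNReal.mul_le_mul_iff_left (by simp [hI0, hfin])
      (by simp [hI0, hfin])).1 h1
  have hpow := ENNReal.rpow_le_rpow hroot hp0.le
  rw [ENNReal.mul_rpow_of_nonneg _ _ hp0.le, ← ENNReal.rpow_mul, ← ENNReal.rpow_mul,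
    one_div_mul_cancel hp0.ne', ENNReal.rpow_one, ENNReal.rpow_one,
    ENNReal.ofReal_rpow_of_nonneg (by positivity) hp0.le] at hpow
  calc _ ≤ ENNReal.ofReal ((c / (b + p)) ^ p) * (ENNReal.ofReal (((b + p) / c) ^ p) * J) := by
        gcongr
    _ = J := by
        rw [← mul_assoc, ← ENNReal.ofReal_mul (by positivity),
          ← Real.mul_rpow (by positivity) (by positivity), div_mul_div_cancel₀ hbp.ne',
          div_self hc.ne', Real.one_rpow, ENNReal.ofReal_one, one_mul]

/-- Euclidean case of the Hardy-type inequality of Theorem 4.2: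
for `d ≥ 3`, `p > 1`, `d + a - p > 0`, `b + p > 0` and every smooth compactly
supported `u : ℝ^d → ℝ`,
`∫ ‖x‖^a |u|^b ‖∇u‖^p ≥ ((a+d-p)/(b+p))^p ∫ ‖x‖^{a-p} |u|^{p+b}`,
the integrals being taken in `[0, ∞]`. -/
theorem hardy_type_inequality_euclidean
    (d : ℕ) (hd : 3 ≤ d) (p a b : ℝ) (hp : 1 < p)
    (hda : 0 < d + a - p) (hbp : 0 < b + p)
    (u : EuclideanSpace ℝ (Fin d) → ℝ) (hu : ContDiff ℝ (⊤ : ℕ∞) u)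
    (hsupp : HasCompactSupport u) :
    ∫⁻ x, (ENNReal.ofReal ‖x‖) ^ a * (ENNReal.ofReal |u x|) ^ b *
        (ENNReal.ofReal ‖fderiv ℝ u x‖) ^ p ≥
      ENNReal.ofReal (((a + d - p) / (b + p)) ^ p) *
        ∫⁻ x, (ENNReal.ofReal ‖x‖) ^ (a - p) * (ENNReal.ofReal |u x|) ^ (p + b) := by
  have : Nontrivial (EuclideanSpace ℝ (Fin d)) :=
    Module.nontrivial_of_finrank_pos (R := ℝ) (by rw [finrank_euclideanSpace_fin]; omega)
  have hum : Measurable u := hu.continuous.measurable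
  have hdum : Measurable (fun x ↦ ‖fderiv ℝ u x‖) :=
    (hu.continuous_fderiv (by simp)).norm.measurable
  have hpow : ∀ (r e : ℝ), 0 < r →
      ENNReal.ofReal (r ^ (d - 1)) * ENNReal.ofReal r ^ e = ENNReal.ofReal r ^ (d + e - 1) := by
    intro r e hr
    rw [ENNReal.ofReal_pow hr.le, ← ENNReal.rpow_natCast,
      ← ENNReal.rpow_add _ _ (by simpa using hr) ENNReal.ofReal_ne_top, Nat.cast_pred (by omega)]
    congr 1
    ring
  rw [ge_iff_le, lintegral_eq_lintegral_toSphere volume (by fun_prop),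
    lintegral_eq_lintegral_toSphere volume (by fun_prop), finrank_euclideanSpace_fin,
    ← lintegral_const_mul' _ _ ENNReal.ofReal_ne_top]
  refine lintegral_mono fun ω ↦ ?_
  have hω : ‖(ω : EuclideanSpace ℝ (Fin d))‖ = 1 := by simp
  set v : ℝ → ℝ := fun r ↦ u (r • (ω : EuclideanSpace ℝ (Fin d))) 
  have hv : ContDiff ℝ 1 v :=
    (hu.of_le (by exact_mod_cast le_top)).comp (contDiff_id.smul contDiff_const)
  have hderiv : ∀ r, |deriv v r| ≤ ‖fderiv ℝ u (r • (ω : EuclideanSpace ℝ (Fin d)))‖ := by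
    intro r
    have h1 : HasDerivAt (fun r : ℝ ↦ r • (ω : EuclideanSpace ℝ (Fin d))) ω r := by
      simpa using (hasDerivAt_id r).smul_const (ω : EuclideanSpace ℝ (Fin d))
    have h2 := ((hu.differentiable (by simp) _).hasFDerivAt.comp_hasDerivAt r h1).deriv
    rw [show deriv v r = _ from h2]
    simpa [hω] using (fderiv ℝ u (r • (ω : EuclideanSpace ℝ (Fin d)))).le_opNorm ω
  obtain ⟨R, hR⟩ : ∃ R, ∀ r, R ≤ r → v r = 0 := by
    obtain ⟨R, hRpos, hR⟩ := hsupp.exists_pos_le_norm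
    refine ⟨R, fun r hr ↦ hR _ ?_⟩
    rw [norm_smul, hω, mul_one]
    exact hr.trans (le_abs_self r)
  calc _ = ENNReal.ofReal (((d + a - p) / (b + p)) ^ p) * ∫⁻ r in Set.Ioi 0,
          ENNReal.ofReal r ^ (d + a - p - 1) * ENNReal.ofReal |v r| ^ (p + b) := by
        rw [add_comm a]
        congr 1
        refine setLIntegral_congr_fun measurableSet_Ioi fun r (hr : 0 < r) ↦ ?_
        simp only [norm_smul, hω, mul_one, Real.norm_of_nonneg hr.le]
        rw [← mul_assoc, hpow _ _ hr, ← add_sub_assoc]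
    _ ≤ _ := hardy_type_inequality_Ioi hv hR hp hda hbp
    _ ≤ _ := by
        refine setLIntegral_mono' measurableSet_Ioi fun r (hr : 0 < r) ↦ ?_
        simp only [norm_smul, hω, mul_one, Real.norm_of_nonneg hr.le]
        rw [← mul_assoc, ← mul_assoc, hpow _ _ hr, sub_add_cancel]
        gcongr
        exact hderiv r
end

section
/- Let d ≥ 1 be an integer and let φ : ℝ^d → ℝ be a smooth function whose (compact) support does not contain the origin. Then ∫_{ℝ^d} ‖x‖^{−d} · ⟨x, ∇φ(x)⟩ dx = 0, where ‖·‖ and ⟨·,·⟩ denote the Euclidean norm and inner product on ℝ^d. -/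
open MeasureTheory RealInnerProductSpace

/-- Integration in polar coordinates with respect to an additive Haar measure. -/
theorem integral_eq_integral_toSphere_integral_Ioi {E F : Type*}
    [NormedAddCommGroup E] [NormedSpace ℝ E] [MeasurableSpace E] [BorelSpace E]
    [FiniteDimensional ℝ E] [NormedAddCommGroup F] [NormedSpace ℝ F]
    [Nontrivial E] (μ : Measure E) [μ.IsAddHaarMeasure] {f : E → F} (hf : Integrable f μ) :
    ∫ x, f x ∂μ = ∫ ω : Metric.sphere (0 : E) 1,
      (∫ r in Set.Ioi (0 : ℝ), r ^ (Module.finrank ℝ E - 1) • f (r • (ω : E))) ∂μ.toSphere := by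
  have hpres := μ.measurePreserving_homeomorphUnitSphereProd
  have hemb := (homeomorphUnitSphereProd E).measurableEmbedding
  have hcomp : (fun p : Metric.sphere (0 : E) 1 × Set.Ioi (0 : ℝ) ↦ f (p.2.1 • p.1.1)) ∘
      homeomorphUnitSphereProd E = fun x : ({0}ᶜ : Set E) ↦ f x := by
    ext x
    have hx : ‖(x : E)‖ ≠ 0 := norm_ne_zero_iff.2 x.2
    simp [smul_smul, hx]
  have hint : Integrable
      (fun p : Metric.sphere (0 : E) 1 × Set.Ioi (0 : ℝ) ↦ f (p.2.1 • p.1.1))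
      (μ.toSphere.prod (.volumeIoiPow (Module.finrank ℝ E - 1))) := by
    rw [← hpres.integrable_comp_emb hemb, hcomp]
    exact (integrableOn_iff_comap_subtypeVal (measurableSet_singleton _).compl).1 hf.integrableOn
  calc
    ∫ x, f x ∂μ = ∫ x : ({0}ᶜ : Set E), f x ∂(μ.comap (↑)) := by
      rw [integral_subtype_comap (measurableSet_singleton _).compl f,
        restrict_compl_singleton]
    _ = ∫ p : Metric.sphere (0 : E) 1 × Set.Ioi (0 : ℝ), f (p.2.1 • p.1.1)
          ∂μ.toSphere.prod (.volumeIoiPow (Module.finrank ℝ E - 1)) := by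
      rw [← hpres.integral_comp hemb]
      exact congrArg (fun g ↦ ∫ x, g x ∂(μ.comap (↑))) hcomp.symm
    _ = ∫ ω : Metric.sphere (0 : E) 1, ∫ r : Set.Ioi (0 : ℝ), f (r.1 • ω.1)
          ∂.volumeIoiPow (Module.finrank ℝ E - 1) ∂μ.toSphere := integral_prod _ hint
    _ = _ := by
      refine integral_congr_ae (.of_forall fun ω ↦ ?_)
      simp only [Measure.volumeIoiPow, ENNReal.ofReal]
      rw [integral_withDensity_eq_integral_smul
        (measurable_subtype_coe.pow_const _).real_toNNReal,
        integral_subtype_comap measurableSet_Ioi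
          fun r ↦ Real.toNNReal (r ^ (Module.finrank ℝ E - 1)) • f (r • ω.1)]
      refine setIntegral_congr_fun measurableSet_Ioi fun r hr ↦ ?_
      simp only [NNReal.smul_def, Real.coe_toNNReal _ (pow_nonneg (le_of_lt hr) _)]

/-- The radial derivative of a compactly supported function integrates along each ray to minus the
value of the function at the origin. -/
theorem integral_Ioi_fderiv_smul {E : Type*} [NormedAddCommGroup E] [NormedSpace ℝ E]
    {φ : E → ℝ} (hφ : ContDiff ℝ 1 φ) (hsupp : HasCompactSupport φ) {v : E} (hv : v ≠ 0) :
    ∫ r in Set.Ioi (0 : ℝ), fderiv ℝ φ (r • v) v = - φ 0 := by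
  have hderiv (r : ℝ) : deriv (fun r : ℝ ↦ φ (r • v)) r = fderiv ℝ φ (r • v) v := by
    have h := ((hφ.differentiable one_ne_zero) (r • v)).hasFDerivAt.comp_hasDerivAt r
      ((hasDerivAt_id r).smul_const v)
    simpa [Function.comp_def] using h.deriv
  have hsupp' : HasCompactSupport fun r : ℝ ↦ φ (r • v) :=
    hsupp.comp_isClosedEmbedding (isClosedEmbedding_smul_left hv)
  have hφ' : ContDiff ℝ 1 fun r : ℝ ↦ φ (r • v) := by fun_prop
  simpa [hderiv] using hsupp'.integral_Ioi_deriv_eq hφ' 0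

/-- The Euclidean divergence-free identity used in Theorem 4.4: for smooth
`φ : ℝ^d → ℝ` with compact support avoiding the origin,
`∫ ‖x‖^{-d} ⟨x, ∇φ(x)⟩ dx = 0`. -/
theorem integral_inner_gradient_div_free
    (d : ℕ) (hd : 1 ≤ d) (φ : EuclideanSpace ℝ (Fin d) → ℝ)
    (hφ : ContDiff ℝ (⊤ : ℕ∞) φ) (hsupp : HasCompactSupport φ)
    (h0 : (0 : EuclideanSpace ℝ (Fin d)) ∉ tsupport φ) :
    ∫ x, ‖x‖ ^ (-(d : ℝ)) * ⟪x, gradient φ x⟫ = 0 := by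
  by_cases hint : Integrable fun x ↦ ‖x‖ ^ (-(d : ℝ)) * ⟪x, gradient φ x⟫
  swap
  · exact integral_undef hint
  have : Nonempty (Fin d) := ⟨⟨0, hd⟩⟩
  rw [integral_eq_integral_toSphere_integral_Ioi volume hint]
  refine integral_eq_zero_of_ae (.of_forall fun ω ↦ ?_)
  have hω : ‖(ω : EuclideanSpace ℝ (Fin d))‖ = 1 := norm_eq_of_mem_sphere ω
  have hray := integral_Ioi_fderiv_smul (hφ.of_le (by simp)) hsupp
    (v := (ω : EuclideanSpace ℝ (Fin d))) (norm_ne_zero_iff.1 (by simp [hω]))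
  rw [image_eq_zero_of_notMem_tsupport h0, neg_zero] at hray
  refine (setIntegral_congr_fun measurableSet_Ioi fun r hr ↦ ?_).trans hray
  have hr : 0 < r := hr
  have hpow : r ^ (d - 1) * (r ^ d)⁻¹ * r = 1 := by
    rw [mul_right_comm, ← pow_succ, Nat.sub_add_cancel hd, mul_inv_cancel₀ (by positivity)]
  simp only [finrank_euclideanSpace, Fintype.card_fin, norm_smul, hω, mul_one, Real.norm_eq_abs,
    abs_of_pos hr, Real.rpow_neg hr.le, Real.rpow_natCast, smul_eq_mul, map_smul,
    real_inner_comm (gradient φ _), inner_gradient_left]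
  linear_combination (fderiv ℝ φ (r • ω.1) ω.1) * hpow
end
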